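/- arXiv:math/0211212 — 3 statements merged into one kernel-verified Lean document; each statement's English description precedes it below -/
import Mathlib

section
/- Let R be a differential space in the sense of Sikorski (a topological space with a differential structure C^∞(R) satisfying: the sets f⁻¹((a,b)) for f ∈ C^∞(R) form a subbasis of the topology; C^∞(R) is closed under composition with smooth functions on ℝⁿ; and C^∞(R) is determined locally). Then for every open subset U of R and every point x ∈ U, there exists f ∈ C^∞(R) such that f restricted to some open neighbourhood V of x contained in U is identically 1, and f restricted to some open set W ⊆ R with U ∪ W = R is identically 0. -/
/-- A differential structure in the sense of Sikorski on a topological space `R`: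
a family `C` of real-valued functions such that (2.1) the preimages of open
intervals form a subbasis of the topology, (2.2) `C` is closed under composition
with smooth functions on `ℝⁿ`, and (2.3) `C` is determined locally. -/
structure DiffStructure (R : Type*) [TopologicalSpace R] where
  C : Set (R → ℝ)
  subbasis : TopologicalSpace.generateFrom
      {s : Set R | ∃ f ∈ C, ∃ a b : ℝ, s = f ⁻¹' Set.Ioo a b}
    = (inferInstance : TopologicalSpace R)
  comp : ∀ (n : ℕ) (f : Fin n → R → ℝ), (∀ i, f i ∈ C) →
      ∀ F : (Fin n → ℝ) → ℝ, ContDiff ℝ (⊤ : ℕ∞) F → (fun x => F (fun i => f i x)) ∈ C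
  locality : ∀ f : R → ℝ,
      (∀ x : R, ∃ U : Set R, IsOpen U ∧ x ∈ U ∧ ∃ g ∈ C, Set.EqOn f g U) → f ∈ C

namespace DiffStructure

variable {R : Type*} [TopologicalSpace R] (D : DiffStructure R)

theorem isOpen_iff_generateOpen {U : Set R} :
    IsOpen U ↔ TopologicalSpace.GenerateOpen
      {s : Set R | ∃ f ∈ D.C, ∃ a b : ℝ, s = f ⁻¹' Set.Ioo a b} U :=
  (TopologicalSpace.ext_iff.mp D.subbasis U).symm

theorem continuous_of_mem {f : R → ℝ} (hf : f ∈ D.C) : Continuous f := by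
  refine Real.isTopologicalBasis_Ioo_rat.continuous_iff.mpr fun s hs => ?_
  simp only [Set.mem_iUnion, Set.mem_singleton_iff] at hs
  obtain ⟨a, b, -, rfl⟩ := hs
  exact D.isOpen_iff_generateOpen.mpr (.basic _ ⟨f, hf, a, b, rfl⟩)

theorem const_mem (c : ℝ) : (fun _ => c) ∈ D.C :=
  D.comp 0 Fin.elim0 (fun i => i.elim0) (fun _ => c) contDiff_const

theorem comp_mem {f : R → ℝ} (hf : f ∈ D.C) {g : ℝ → ℝ} (hg : ContDiff ℝ (⊤ : ℕ∞) g) :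
    (fun y => g (f y)) ∈ D.C :=
  D.comp 1 (fun _ => f) (fun _ => hf) (fun v => g (v 0)) (hg.comp (contDiff_apply ℝ ℝ 0))

theorem mul_mem {f g : R → ℝ} (hf : f ∈ D.C) (hg : g ∈ D.C) : (fun y => f y * g y) ∈ D.C :=
  D.comp 2 ![f, g] (Fin.forall_fin_two.mpr ⟨hf, hg⟩) (fun v => v 0 * v 1)
    ((contDiff_apply ℝ ℝ 0).mul (contDiff_apply ℝ ℝ 1))

/-- A function of the structure that is `1` near `x`, inside `U`, and `0` on an open set
which together with `U` covers the space. -/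
def HasBumpAt (U : Set R) (x : R) : Prop :=
  ∃ f ∈ D.C,
    (∃ V : Set R, IsOpen V ∧ x ∈ V ∧ V ⊆ U ∧ ∀ y ∈ V, f y = 1) ∧
    (∃ W : Set R, IsOpen W ∧ U ∪ W = Set.univ ∧ ∀ y ∈ W, f y = 0)

variable {D}

theorem HasBumpAt.mono {U U' : Set R} {x : R} (h : D.HasBumpAt U x) (hU : U ⊆ U') :
    D.HasBumpAt U' x := by
  obtain ⟨f, hf, ⟨V, hV, hxV, hVU, hV1⟩, W, hW, hUW, hW0⟩ := h
  exact ⟨f, hf, ⟨V, hV, hxV, hVU.trans hU, hV1⟩, W, hW,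
    Set.univ_subset_iff.mp (hUW ▸ Set.union_subset_union_left W hU), hW0⟩

theorem HasBumpAt.inter {U U' : Set R} {x : R} (h : D.HasBumpAt U x) (h' : D.HasBumpAt U' x) :
    D.HasBumpAt (U ∩ U') x := by
  obtain ⟨f, hf, ⟨V, hV, hxV, hVU, hV1⟩, W, hW, hUW, hW0⟩ := h
  obtain ⟨g, hg, ⟨V', hV', hxV', hVU', hV1'⟩, W', hW', hUW', hW0'⟩ := h'
  refine ⟨_, D.mul_mem hf hg,
    ⟨V ∩ V', hV.inter hV', ⟨hxV, hxV'⟩, Set.inter_subset_inter hVU hVU', fun y hy => ?_⟩,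
    W ∪ W', hW.union hW', Set.eq_univ_of_forall fun y => ?_, ?_⟩
  · rw [hV1 y hy.1, hV1' y hy.2, one_mul]
  · rcases hUW ▸ Set.mem_univ y with hy | hy
    · rcases hUW' ▸ Set.mem_univ y with hy' | hy'
      · exact .inl ⟨hy, hy'⟩
      · exact .inr (.inr hy')
    · exact .inr (.inl hy)
  · rintro y (hy | hy)
    · rw [hW0 y hy, zero_mul]
    · rw [hW0' y hy, mul_zero]

variable (D) in
theorem hasBumpAt_univ (x : R) : D.HasBumpAt Set.univ x :=
  ⟨_, D.const_mem 1, ⟨Set.univ, isOpen_univ, trivial, subset_rfl, fun _ _ => rfl⟩,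
    ∅, isOpen_empty, Set.union_empty _, fun _ hy => hy.elim⟩

theorem hasBumpAt_preimage {f : R → ℝ} (hf : f ∈ D.C) {s : Set ℝ} (hs : IsOpen s) {x : R}
    (hx : f x ∈ s) : D.HasBumpAt (f ⁻¹' s) x := by
  obtain ⟨r, hr, hrs⟩ := Metric.isOpen_iff.mp hs _ hx
  have hf' := D.continuous_of_mem hf
  let φ : ContDiffBump (f x) := ⟨r / 3, r / 2, by linarith, by linarith⟩
  refine ⟨_, D.comp_mem hf φ.contDiff,
    ⟨f ⁻¹' Metric.ball (f x) (r / 3), Metric.isOpen_ball.preimage hf',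
      Metric.mem_ball_self (by linarith),
      Set.preimage_mono ((Metric.ball_subset_ball (by linarith)).trans hrs),
      fun y hy => φ.one_of_mem_closedBall (Metric.ball_subset_closedBall hy)⟩,
    f ⁻¹' (Metric.closedBall (f x) (r / 2))ᶜ,
    Metric.isClosed_closedBall.isOpen_compl.preimage hf',
    Set.eq_univ_of_forall fun y => ?_, fun y hy => φ.zero_of_le_dist ?_⟩
  · by_cases hy : f y ∈ Metric.closedBall (f x) (r / 2)
    · exact .inl (hrs (Metric.closedBall_subset_ball (by linarith) hy))
    · exact .inr hy
  · exact (not_le.mp fun h => hy (Metric.mem_closedBall.mpr h)).le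

theorem hasBumpAt_of_isOpen {U : Set R} (hU : IsOpen U) {x : R} (hx : x ∈ U) :
    D.HasBumpAt U x := by
  induction D.isOpen_iff_generateOpen.mp hU with
  | basic s hs =>
    obtain ⟨f, hf, a, b, rfl⟩ := hs
    exact hasBumpAt_preimage hf isOpen_Ioo hx
  | univ => exact D.hasBumpAt_univ x
  | inter s t hs ht ihs iht =>
    exact (ihs (D.isOpen_iff_generateOpen.mpr hs) hx.1).inter
      (iht (D.isOpen_iff_generateOpen.mpr ht) hx.2)
  | sUnion S hS ih =>
    obtain ⟨s, hs, hxs⟩ := hx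
    exact (ih s hs (D.isOpen_iff_generateOpen.mpr (hS s hs)) hxs).mono
      (Set.subset_sUnion_of_mem hs)

end DiffStructure

/-- Lemma 1: For every open subset `U` of a differential space `R`
and every `x ∈ U`, there exists `f ∈ C^∞(R)` with `f = 1` on some open
neighbourhood `V ⊆ U` of `x`, and `f = 0` on some open `W` with `U ∪ W = R`. -/
theorem stmt_0 {R : Type*} [TopologicalSpace R] (D : DiffStructure R)
    (U : Set R) (hU : IsOpen U) (x : R) (hx : x ∈ U) :
    ∃ f ∈ D.C,
      (∃ V : Set R, IsOpen V ∧ x ∈ V ∧ V ⊆ U ∧ ∀ y ∈ V, f y = 1) ∧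
      (∃ W : Set R, IsOpen W ∧ U ∪ W = Set.univ ∧ ∀ y ∈ W, f y = 0) := by
  exact DiffStructure.hasBumpAt_of_isOpen hU hx
end

section
/- Let S = [0,∞) ⊆ ℝ with the induced differential structure, and let X be the derivation of C^∞([0,∞)) given by X·f = f' (the one-sided derivative at 0). Then X is not a vector field on S: for every open neighbourhood U of 0 in [0,∞) and every t > 0 for which the translation flow φₜ(x) = x + t is defined on U, the image φₜ(U) is not an open subset of [0,∞) containing a neighbourhood of t. However, for every f ∈ C^∞([0,∞)) with f(0) = 0, the derivation fX is a vector field on S. -/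
/-- `h` is a smooth function of the differential subspace `S ⊆ ℝ`: near every
point of `S` it agrees on `S` with a smooth function on `ℝ`. -/
def SmoothOnSub (S : Set ℝ) (h : ℝ → ℝ) : Prop :=
  ∀ x ∈ S, ∃ U : Set ℝ, IsOpen U ∧ x ∈ U ∧
    ∃ F : ℝ → ℝ, ContDiff ℝ (⊤ : ℕ∞) F ∧ Set.EqOn h F (U ∩ S)

/-- A derivation `Y` of `C^∞(S)`, `S ⊆ ℝ`, is a vector field on `S`: every point
has a neighbourhood `V ∩ S` and `ε > 0` such that for `|t| < ε` the time-`t`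
flow map `φ t` of `Y` is defined on `V ∩ S` and is a diffeomorphism of `V ∩ S`
onto an open subset of `S`. -/
def IsVectorFieldOn (S : Set ℝ) (Y : (ℝ → ℝ) → (ℝ → ℝ)) : Prop :=
  ∀ x ∈ S, ∃ V : Set ℝ, IsOpen V ∧ x ∈ V ∧ ∃ ε > (0 : ℝ), ∃ φ : ℝ → ℝ → ℝ,
    (∀ y ∈ V ∩ S, φ 0 y = y) ∧
    (∀ t : ℝ, |t| < ε → ∀ y ∈ V ∩ S, φ t y ∈ S) ∧
    -- each curve t ↦ φ t y is an integral curve of the derivation Y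
    (∀ y ∈ V ∩ S, ∀ h : ℝ → ℝ, SmoothOnSub S h → ∀ t : ℝ, |t| < ε →
        HasDerivAt (fun s => h (φ s y)) (Y h (φ t y)) t) ∧
    -- each φ t is a diffeomorphism of V ∩ S onto an open subset of S
    (∀ t : ℝ, |t| < ε →
      Set.InjOn (φ t) (V ∩ S) ∧
      (∃ W : Set ℝ, IsOpen W ∧ φ t '' (V ∩ S) = W ∩ S) ∧
      (∀ h : ℝ → ℝ, SmoothOnSub (φ t '' (V ∩ S)) h →
        SmoothOnSub (V ∩ S) (fun y => h (φ t y))) ∧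
      (∃ ψ : ℝ → ℝ, (∀ y ∈ V ∩ S, ψ (φ t y) = y) ∧
        ∀ h : ℝ → ℝ, SmoothOnSub (V ∩ S) h →
          SmoothOnSub (φ t '' (V ∩ S)) (fun z => h (ψ z))))

open Set Filter Topology MeasureTheory
open scoped NNReal ContDiff

/-! ### Families of functions depending smoothly on one variable -/

/-- `g s x` is `n` times differentiable in `x`, and all these derivatives are jointly continuous
in `(s, x)`. -/
def ContDiffSnd : ℕ → (ℝ → ℝ → ℝ) → Prop
  | 0, g => Continuous (Function.uncurry g)
  | n + 1, g => Continuous (Function.uncurry g) ∧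
      ∃ g' : ℝ → ℝ → ℝ, (∀ s x, HasDerivAt (g s) (g' s x) x) ∧ ContDiffSnd n g'

namespace ContDiffSnd

theorem continuous {n : ℕ} {g : ℝ → ℝ → ℝ} (hg : ContDiffSnd n g) :
    Continuous (Function.uncurry g) := by
  cases n with
  | zero => exact hg
  | succ n => exact hg.1

theorem of_succ {n : ℕ} {g : ℝ → ℝ → ℝ} (hg : ContDiffSnd (n + 1) g) : ContDiffSnd n g := by
  induction n generalizing g with
  | zero => exact hg.1
  | succ n ih =>
    obtain ⟨hc, g', hd, hg'⟩ := hg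
    exact ⟨hc, g', hd, ih hg'⟩

theorem contDiff {n : ℕ} {g : ℝ → ℝ → ℝ} (hg : ContDiffSnd n g) (s : ℝ) :
    ContDiff ℝ n (g s) := by
  induction n generalizing g with
  | zero => exact contDiff_zero.2 (hg.continuous.comp (Continuous.prodMk_right s))
  | succ n ih =>
    obtain ⟨-, g', hd, hg'⟩ := hg
    have hderiv : deriv (g s) = g' s := funext fun x => (hd s x).deriv
    push_cast
    exact contDiff_succ_iff_deriv.2
      ⟨fun x => (hd s x).differentiableAt, by simp, hderiv ▸ ih hg'⟩

theorem add {n : ℕ} {g h : ℝ → ℝ → ℝ} (hg : ContDiffSnd n g) (hh : ContDiffSnd n h) :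
    ContDiffSnd n (fun s x => g s x + h s x) := by
  induction n generalizing g h with
  | zero => exact Continuous.add hg hh
  | succ n ih =>
    obtain ⟨hgc, g', hgd, hg'⟩ := hg
    obtain ⟨hhc, h', hhd, hh'⟩ := hh
    exact ⟨hgc.add hhc, _, fun s x => (hgd s x).add (hhd s x), ih hg' hh'⟩

theorem mul {n : ℕ} {g h : ℝ → ℝ → ℝ} (hg : ContDiffSnd n g) (hh : ContDiffSnd n h) :
    ContDiffSnd n (fun s x => g s x * h s x) := by
  induction n generalizing g h with
  | zero => exact Continuous.mul hg hh
  | succ n ih =>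
    have hg₀ := hg.of_succ
    have hh₀ := hh.of_succ
    obtain ⟨hgc, g', hgd, hg'⟩ := hg
    obtain ⟨hhc, h', hhd, hh'⟩ := hh
    exact ⟨hgc.mul hhc, _, fun s x => (hgd s x).mul (hhd s x), (ih hg' hh₀).add (ih hg₀ hh')⟩

theorem comp {n : ℕ} {G : ℝ → ℝ} {g : ℝ → ℝ → ℝ} (hG : ContDiff ℝ ∞ G)
    (hg : ContDiffSnd n g) : ContDiffSnd n (fun s x => G (g s x)) := by
  induction n generalizing G g with
  | zero => exact hG.continuous.comp hg
  | succ n ih =>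
    have hg₀ := hg.of_succ
    obtain ⟨hgc, g', hgd, hg'⟩ := hg
    obtain ⟨hGd, hG'⟩ := contDiff_infty_iff_deriv.1 hG
    exact ⟨hG.continuous.comp hgc, _, fun s x => (hGd (g s x)).hasDerivAt.comp x (hgd s x),
      (ih hG' hg₀).mul hg'⟩

end ContDiffSnd

theorem hasDerivAt_intervalIntegral_of_continuous {g g' : ℝ → ℝ → ℝ}
    (hg : Continuous (Function.uncurry g)) (hg' : Continuous (Function.uncurry g'))
    (hd : ∀ s x, HasDerivAt (g s) (g' s x) x) (a b x : ℝ) :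
    HasDerivAt (fun y => ∫ s in a..b, g s y) (∫ s in a..b, g' s x) x := by
  have hgx : ∀ y, Continuous fun s => g s y := fun y => hg.comp (Continuous.prodMk_left y)
  have hgx' : ∀ y, Continuous fun s => g' s y := fun y => hg'.comp (Continuous.prodMk_left y)
  obtain ⟨C, hC⟩ := (isCompact_uIcc (a := a) (b := b)).prod (isCompact_closedBall x 1)
    |>.exists_bound_of_continuousOn hg'.continuousOn
  refine (intervalIntegral.hasDerivAt_integral_of_dominated_loc_of_deriv_le
    (F := fun y s => g s y) (F' := fun y s => g' s y) (bound := fun _ => C)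
    (Metric.closedBall_mem_nhds x one_pos)
    (.of_forall fun y => (hgx y).aestronglyMeasurable) ((hgx x).intervalIntegrable _ _)
    (hgx' x).aestronglyMeasurable (.of_forall fun s hs y hy => ?_)
    intervalIntegrable_const (.of_forall fun s _ y _ => hd s y)).2
  exact hC (s, y) ⟨uIoc_subset_uIcc hs, hy⟩

theorem ContDiffSnd.integral {n : ℕ} {g : ℝ → ℝ → ℝ} (hg : ContDiffSnd n g) :
    ContDiffSnd n (fun t x => ∫ s in (0 : ℝ)..t, g s x) := by
  have key : ∀ {g : ℝ → ℝ → ℝ}, Continuous (Function.uncurry g) →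
      Continuous (Function.uncurry fun t x => ∫ s in (0 : ℝ)..t, g s x) := fun {g} hg =>
    intervalIntegral.continuous_parametric_intervalIntegral_of_continuous
      (f := fun p : ℝ × ℝ => fun s => g s p.2)
      (hg.comp (continuous_snd.prodMk (continuous_snd.comp continuous_fst))) continuous_fst
  induction n generalizing g with
  | zero => exact key hg
  | succ n ih =>
    obtain ⟨hgc, g', hgd, hg'⟩ := hg
    exact ⟨key hgc, _, fun t x =>
      hasDerivAt_intervalIntegral_of_continuous hgc hg'.continuous hgd 0 t x, ih hg'⟩

/-! ### Global flows on the line -/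

theorem exists_forall_hasDerivAt_of_lipschitzWith {F : ℝ → ℝ} {K L : ℝ≥0}
    (hK : LipschitzWith K F) (hL : ∀ x, ‖F x‖ ≤ L) (x : ℝ) :
    ∃ γ : ℝ → ℝ, γ 0 = x ∧ ∀ t, HasDerivAt γ (F (γ t)) t := by
  have hloc : ∀ T : ℝ, ∃ γ : ℝ → ℝ, 0 < T → γ 0 = x ∧
      ∀ t ∈ Ioo (-T) T, HasDerivAt γ (F (γ t)) t := by
    intro T
    by_cases hT : 0 < T
    · have hPL : IsPicardLindelof (fun _ => F) (tmin := -T) (tmax := T)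
          ⟨0, by constructor <;> linarith⟩ x (L * ⟨T, hT.le⟩) 0 L K :=
        .of_time_independent (fun y _ => hL y) hK.lipschitzOnWith (by simp; rfl)
      obtain ⟨γ, hγ0, hγ⟩ := hPL.exists_eq_forall_mem_Icc_hasDerivWithinAt₀
      exact ⟨γ, fun _ => ⟨hγ0, fun t ht => (hγ t (Ioo_subset_Icc_self ht)).hasDerivAt
        (Icc_mem_nhds ht.1 ht.2)⟩⟩
    · exact ⟨0, fun h => absurd h hT⟩
  choose γ hγ using hloc
  have heq : ∀ S T t, 0 < S → S ≤ T → t ∈ Ioo (-S) S → γ S t = γ T t := by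
    intro S T t hS hST ht
    have hT := hS.trans_le hST
    refine ODE_solution_unique_of_mem_Ioo (v := fun _ => F) (s := fun _ => univ) (t₀ := 0)
      (fun _ _ => hK.lipschitzOnWith) (by constructor <;> linarith)
      (fun s hs => ⟨(hγ S hS).2 s hs, trivial⟩)
      (fun s hs => ⟨(hγ T hT).2 s ⟨by linarith [hs.1], by linarith [hs.2]⟩, trivial⟩)
      ((hγ S hS).1.trans (hγ T hT).1.symm) ht
  have hmem : ∀ t : ℝ, t ∈ Ioo (-(|t| + 1)) (|t| + 1) := fun t =>
    abs_lt.1 (lt_add_one |t|)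
  refine ⟨fun t => γ (|t| + 1) t, (hγ _ (by positivity)).1, fun t => ?_⟩
  have hev : (fun s => γ (|s| + 1) s) =ᶠ[𝓝 t] γ (|t| + 2) := by
    filter_upwards [continuous_abs.continuousAt.eventually_lt continuousAt_const
      (lt_add_one |t|)] with s hs
    exact heq _ _ s (by positivity) (by linarith) (hmem s)
  have hd := (hγ (|t| + 2) (by positivity)).2 t (abs_lt.1 (by linarith))
  simpa only [hev.eq_of_nhds] using hd.congr_of_eventuallyEq hev

/-- The mean value of `F'` over the segment from `a` to `b`. -/
noncomputable def meanDeriv (F : ℝ → ℝ) (a b : ℝ) : ℝ :=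
  ∫ σ in (0 : ℝ)..1, deriv F (a + σ * (b - a))

theorem meanDeriv_self (F : ℝ → ℝ) (a : ℝ) : meanDeriv F a a = deriv F a := by
  simp [meanDeriv]

theorem meanDeriv_mul_sub {F : ℝ → ℝ} (hF : ContDiff ℝ ∞ F) (a b : ℝ) :
    meanDeriv F a b * (b - a) = F b - F a := by
  obtain ⟨hd, hd'⟩ := contDiff_infty_iff_deriv.1 hF
  have hc := hd'.continuous
  have h := intervalIntegral.integral_eq_sub_of_hasDerivAt (a := (0 : ℝ)) (b := 1)
    (f := fun σ => F (a + σ * (b - a))) (f' := fun σ => deriv F (a + σ * (b - a)) * (b - a))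
    (fun σ _ => (hd _).hasDerivAt.comp σ
      (by simpa using ((hasDerivAt_id σ).mul_const (b - a)).const_add a))
    (Continuous.intervalIntegrable (by fun_prop) _ _)
  rw [intervalIntegral.integral_mul_const] at h
  simpa [meanDeriv] using h

theorem continuous_meanDeriv {F : ℝ → ℝ} (hF : ContDiff ℝ ∞ F) :
    Continuous (Function.uncurry (meanDeriv F)) := by
  have hc := (contDiff_infty_iff_deriv.1 hF).2.continuous
  exact intervalIntegral.continuous_parametric_intervalIntegral_of_continuous'
    (f := fun p : ℝ × ℝ => fun σ => deriv F (p.1 + σ * (p.2 - p.1))) (by fun_prop) 0 1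

theorem norm_meanDeriv_le {F : ℝ → ℝ} {K : ℝ≥0} (hK : LipschitzWith K F) (a b : ℝ) :
    ‖meanDeriv F a b‖ ≤ K := by
  simpa [meanDeriv] using intervalIntegral.norm_integral_le_of_norm_le_const
    (a := (0 : ℝ)) (b := 1) (f := fun σ => deriv F (a + σ * (b - a)))
    fun σ _ => norm_deriv_le_of_lipschitz hK

/-- `φ` is a global flow of the vector field `F` on `ℝ`. -/
structure IsGlobalFlow (F : ℝ → ℝ) (φ : ℝ → ℝ → ℝ) : Prop where
  zero : ∀ x, φ 0 x = x
  hasDerivAt : ∀ x t, HasDerivAt (fun s => φ s x) (F (φ t x)) t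

namespace IsGlobalFlow

variable {F : ℝ → ℝ} {φ : ℝ → ℝ → ℝ} {K : ℝ≥0}

theorem continuous_left (hφ : IsGlobalFlow F φ) (x : ℝ) : Continuous fun t => φ t x :=
  continuous_iff_continuousAt.2 fun t => (hφ.hasDerivAt x t).continuousAt

theorem add (hφ : IsGlobalFlow F φ) (hK : LipschitzWith K F) (s t x : ℝ) :
    φ (s + t) x = φ s (φ t x) := by
  refine congrFun (ODE_solution_unique_univ (v := fun _ => F) (s := fun _ => univ) (t₀ := 0)
    (f := fun s => φ (s + t) x) (g := fun s => φ s (φ t x))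
    (fun _ => hK.lipschitzOnWith) (fun s => ⟨?_, trivial⟩)
    (fun s => ⟨hφ.hasDerivAt _ s, trivial⟩) (by simp [hφ.zero])) s
  exact (hφ.hasDerivAt x (s + t)).comp_add_const s t

theorem neg_apply (hφ : IsGlobalFlow F φ) (hK : LipschitzWith K F) (t x : ℝ) :
    φ (-t) (φ t x) = x := by
  rw [← hφ.add hK, neg_add_cancel, hφ.zero]

theorem apply_neg (hφ : IsGlobalFlow F φ) (hK : LipschitzWith K F) (t x : ℝ) :
    φ t (φ (-t) x) = x := by
  simpa using hφ.neg_apply hK (-t) x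

theorem apply_of_eq_zero (hφ : IsGlobalFlow F φ) (hK : LipschitzWith K F) {x : ℝ}
    (hx : F x = 0) (t : ℝ) : φ t x = x := by
  refine congrFun (ODE_solution_unique_univ (v := fun _ => F) (s := fun _ => univ) (t₀ := 0)
    (f := fun s => φ s x) (g := fun _ => x)
    (fun _ => hK.lipschitzOnWith) (fun s => ⟨hφ.hasDerivAt _ s, trivial⟩)
    (fun s => ⟨?_, trivial⟩) (hφ.zero x)) t
  simpa [hx] using hasDerivAt_const s x

theorem sub_eq (hφ : IsGlobalFlow F φ) (hF : ContDiff ℝ ∞ F) (t x y : ℝ) :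
    φ t y - φ t x = (y - x) * Real.exp (∫ s in (0 : ℝ)..t, meanDeriv F (φ s x) (φ s y)) := by
  have hc : Continuous fun s => meanDeriv F (φ s x) (φ s y) :=
    (continuous_meanDeriv hF).comp ((hφ.continuous_left x).prodMk (hφ.continuous_left y))
  set I : ℝ → ℝ := fun t => ∫ s in (0 : ℝ)..t, meanDeriv F (φ s x) (φ s y)
  have hI : ∀ t, HasDerivAt I (meanDeriv F (φ t x) (φ t y)) t := fun t =>
    hc.integral_hasStrictDerivAt 0 t |>.hasDerivAt
  have hw : ∀ t, HasDerivAt (fun s => (φ s y - φ s x) * Real.exp (-I s)) 0 t := by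
    intro t
    have h := ((hφ.hasDerivAt y t).sub (hφ.hasDerivAt x t)).mul (hI t).neg.exp
    refine h.congr_deriv ?_
    rw [← meanDeriv_mul_sub hF]
    simp only [Pi.sub_apply]
    ring
  have hconst := is_const_of_deriv_eq_zero (fun t => (hw t).differentiableAt)
    (fun t => (hw t).deriv) t 0
  have hI0 : I 0 = 0 := intervalIntegral.integral_same
  simp only [hφ.zero, hI0, neg_zero, Real.exp_zero, mul_one] at hconst
  rw [← hconst, mul_assoc, ← Real.exp_add, neg_add_cancel, Real.exp_zero, mul_one]

theorem strictMono (hφ : IsGlobalFlow F φ) (hF : ContDiff ℝ ∞ F) (t : ℝ) :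
    StrictMono (φ t) := fun x y hxy => by
  rw [← sub_pos, hφ.sub_eq hF]
  exact mul_pos (sub_pos.2 hxy) (Real.exp_pos _)

theorem dist_le (hφ : IsGlobalFlow F φ) (hF : ContDiff ℝ ∞ F) (hK : LipschitzWith K F)
    (t x y : ℝ) : dist (φ t y) (φ t x) ≤ dist y x * Real.exp (K * |t|) := by
  rw [Real.dist_eq, Real.dist_eq, hφ.sub_eq hF, abs_mul, Real.abs_exp]
  gcongr
  refine (le_abs_self _).trans ?_
  simpa using intervalIntegral.norm_integral_le_of_norm_le_const (a := (0 : ℝ)) (b := t)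
    (f := fun s => meanDeriv F (φ s x) (φ s y)) fun s _ => norm_meanDeriv_le hK _ _

theorem continuous (hφ : IsGlobalFlow F φ) (hF : ContDiff ℝ ∞ F) (hK : LipschitzWith K F) :
    Continuous (Function.uncurry φ) := by
  refine continuous_iff_continuousAt.2 fun ⟨t, x⟩ => tendsto_iff_dist_tendsto_zero.2 ?_
  have hbound : Continuous fun p : ℝ × ℝ =>
      dist p.2 x * Real.exp (K * |p.1|) + dist (φ p.1 x) (φ t x) := by
    have : Continuous fun p : ℝ × ℝ => φ p.1 x := (hφ.continuous_left x).comp continuous_fst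
    exact .add (by fun_prop) (this.dist continuous_const)
  refine squeeze_zero (fun _ => dist_nonneg) (fun p => (dist_triangle _ (φ p.1 x) _).trans
    (add_le_add_left (hφ.dist_le hF hK p.1 x p.2) _)) ?_
  simpa using hbound.tendsto (t, x)

theorem hasDerivAt_right (hφ : IsGlobalFlow F φ) (hF : ContDiff ℝ ∞ F)
    (hK : LipschitzWith K F) (t x : ℝ) :
    HasDerivAt (φ t) (Real.exp (∫ s in (0 : ℝ)..t, deriv F (φ s x))) x := by
  have hc := hφ.continuous hF hK
  have hE : Continuous fun y =>
      Real.exp (∫ s in (0 : ℝ)..t, meanDeriv F (φ s x) (φ s y)) := by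
    refine Real.continuous_exp.comp
      (intervalIntegral.continuous_parametric_intervalIntegral_of_continuous'
        (f := fun y s => meanDeriv F (φ s x) (φ s y)) ?_ 0 t)
    exact (continuous_meanDeriv hF).comp
      (((hφ.continuous_left x).comp continuous_snd).prodMk (hc.comp continuous_swap))
  have hlim := (hE.tendsto x).mono_left (nhdsWithin_le_nhds (s := {x}ᶜ))
  simp only [meanDeriv_self] at hlim
  refine hasDerivAt_iff_tendsto_slope.2 (hlim.congr' ?_)
  filter_upwards [self_mem_nhdsWithin] with y hy
  rw [slope_def_field, hφ.sub_eq hF, mul_div_cancel_left₀ _ (sub_ne_zero.2 hy)]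

theorem contDiff (hφ : IsGlobalFlow F φ) (hF : ContDiff ℝ ∞ F) (hK : LipschitzWith K F)
    (t : ℝ) : ContDiff ℝ ∞ (φ t) := by
  have h : ∀ n, ContDiffSnd n φ := fun n => by
    induction n with
    | zero => exact hφ.continuous hF hK
    | succ n ih =>
      exact ⟨hφ.continuous hF hK, _, fun s x => hφ.hasDerivAt_right hF hK s x,
        (ih.comp (contDiff_infty_iff_deriv.1 hF).2).integral.comp Real.contDiff_exp⟩
  exact contDiff_infty.2 fun n => (h n).contDiff t

end IsGlobalFlow

theorem exists_isGlobalFlow {F : ℝ → ℝ} {K L : ℝ≥0} (hK : LipschitzWith K F)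
    (hL : ∀ x, ‖F x‖ ≤ L) : ∃ φ, IsGlobalFlow F φ := by
  choose γ h0 hd using exists_forall_hasDerivAt_of_lipschitzWith hK hL
  exact ⟨fun t x => γ x t, h0, hd⟩

/-! ### Vector fields on the half-line -/

theorem SmoothOnSub.comp {A B : Set ℝ} {h g : ℝ → ℝ} (hh : SmoothOnSub A h)
    (hg : ContDiff ℝ ∞ g) (hAB : MapsTo g B A) : SmoothOnSub B (fun y => h (g y)) := by
  intro x hx
  obtain ⟨U, hU, hxU, H, hH, heq⟩ := hh (g x) (hAB hx)
  exact ⟨g ⁻¹' U, hU.preimage hg.continuous, hxU, fun y => H (g y), hH.comp hg,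
    fun y hy => heq ⟨hy.1, hAB hy.2⟩⟩

/-- A smooth function on `[0, ∞)` vanishing at `0` agrees near any point of `[0, ∞)` with a
compactly supported smooth function on `ℝ` vanishing at `0`. -/
theorem SmoothOnSub.exists_hasCompactSupport {f : ℝ → ℝ} (hf : SmoothOnSub (Ici 0) f)
    (hf0 : f 0 = 0) {x : ℝ} (hx : x ∈ Ici (0 : ℝ)) :
    ∃ F : ℝ → ℝ, ContDiff ℝ ∞ F ∧ HasCompactSupport F ∧ F 0 = 0 ∧
      ∃ W : Set ℝ, IsOpen W ∧ x ∈ W ∧ EqOn f F (W ∩ Ici 0) := by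
  obtain ⟨U, hU, hxU, G, hG, heq⟩ := hf x hx
  obtain ⟨R, hR, hRU⟩ := Metric.isOpen_iff.1 hU x hxU
  let χ : ContDiffBump x := ⟨R / 2, R, by linarith, by linarith⟩
  refine ⟨fun y => χ y * G y, χ.contDiff.mul hG, χ.hasCompactSupport.mul_right, ?_,
    Metric.ball x (R / 2), Metric.isOpen_ball, Metric.mem_ball_self (by linarith),
    fun y hy => ?_⟩
  · by_cases h0 : (0 : ℝ) ∈ U
    · simp [← heq ⟨h0, self_mem_Ici⟩, hf0]
    · have : χ 0 = 0 := χ.zero_of_le_dist (not_lt.1 fun h => h0 (hRU h))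
      simp [this]
  · have hyU : y ∈ U := hRU (Metric.ball_subset_ball (by linarith) hy.1)
    simp [χ.one_of_mem_closedBall (Metric.ball_subset_closedBall hy.1), heq ⟨hyU, hy.2⟩]

theorem image_add_notMem_nhdsWithin_Ici (V : Set ℝ) {t : ℝ} (ht : 0 < t) :
    (fun x => x + t) '' (V ∩ Ici 0) ∉ 𝓝[Ici 0] t := by
  intro hmem
  have hmem' : (fun x => x + t) '' (V ∩ Ici 0) ∈ 𝓝 t := by
    rwa [nhdsWithin_eq_nhds.2 (Ici_mem_nhds ht)] at hmem
  have hsub : (fun x => x + t) '' (V ∩ Ici 0) ⊆ Ici t := by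
    rintro _ ⟨x, hx, rfl⟩
    simpa using hx.2
  have hint := mem_interior_iff_mem_nhds.2 (mem_of_superset hmem' hsub)
  simp at hint

/-- Example 1: On `S = [0,∞)`, the derivation `X·f = f'` is not a
vector field: the translation flow `φₜ(x) = x + t` maps neighbourhoods of `0`
in `S` to sets which are not neighbourhoods of `t` in `S`.  However, for every
`f ∈ C^∞([0,∞))` with `f(0) = 0`, the derivation `fX` is a vector field. -/
theorem stmt_6 (X : (ℝ → ℝ) → (ℝ → ℝ))
    (hX : ∀ h : ℝ → ℝ, SmoothOnSub (Set.Ici 0) h → ∀ x ∈ Set.Ici (0 : ℝ),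
      ∀ U : Set ℝ, IsOpen U → x ∈ U → ∀ F : ℝ → ℝ, ContDiff ℝ (⊤ : ℕ∞) F →
        Set.EqOn h F (U ∩ Set.Ici 0) → X h x = deriv F x) :
    (∀ V : Set ℝ, IsOpen V → (0 : ℝ) ∈ V → ∀ t > (0 : ℝ),
        ¬ ((fun x => x + t) '' (V ∩ Set.Ici 0) ∈ nhdsWithin t (Set.Ici 0))) ∧
    (∀ f : ℝ → ℝ, SmoothOnSub (Set.Ici 0) f → f 0 = 0 →
        IsVectorFieldOn (Set.Ici 0) (fun h x => f x * X h x)) := by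
  refine ⟨fun V _ _ t ht => image_add_notMem_nhdsWithin_Ici V ht, fun f hf hf0 x hx => ?_⟩
  obtain ⟨F, hF, hFc, hF0, W, hW, hxW, hfF⟩ := hf.exists_hasCompactSupport hf0 hx
  obtain ⟨K, hK⟩ := hF.lipschitzWith_of_hasCompactSupport hFc (by simp)
  obtain ⟨L, hL⟩ := hFc.exists_bound_of_continuous hF.continuous
  obtain ⟨φ, hφ⟩ := exists_isGlobalFlow (L := L.toNNReal) hK
    fun x => (hL x).trans (Real.le_coe_toNNReal L)
  have hmaps : ∀ t, MapsTo (φ t) (Ici 0) (Ici 0) := fun t y hy => by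
    simpa only [hφ.apply_of_eq_zero hK hF0, mem_Ici] using (hφ.strictMono hF t).monotone hy
  obtain ⟨T, hT, V, hV, hTV⟩ : ∃ T ∈ 𝓝 (0 : ℝ), ∃ V ∈ 𝓝 x, T ×ˢ V ⊆ Function.uncurry φ ⁻¹' W :=
    mem_nhds_prod_iff.1 ((hφ.continuous hF hK).continuousAt.preimage_mem_nhds
      (hW.mem_nhds (by simpa [hφ.zero] using hxW)))
  obtain ⟨ε, hε, hεT⟩ := Metric.mem_nhds_iff.1 hT
  obtain ⟨V', hV'V, hV', hxV'⟩ := mem_nhds_iff.1 hV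
  refine ⟨V', hV', hxV', ε, hε, φ, fun y _ => hφ.zero y, fun t _ y hy => hmaps t hy.2,
    fun y hy h hh t ht => ?_, fun t _ => ⟨(hφ.strictMono hF t).injective.injOn,
      ⟨φ (-t) ⁻¹' V', hV'.preimage (hφ.contDiff hF hK _).continuous, ?_⟩,
      fun h hh => hh.comp (hφ.contDiff hF hK t) (mapsTo_image _ _),
      φ (-t), fun y _ => hφ.neg_apply hK t y, fun h hh => hh.comp (hφ.contDiff hF hK _) ?_⟩⟩
  · have hφW : φ t y ∈ W := hTV (mk_mem_prod (hεT (by simpa using ht)) (hV'V hy.1))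
    obtain ⟨U, hU, hyU, H, hH, hhH⟩ := hh (φ t y) (hmaps t hy.2)
    simp only [hX h hh _ (hmaps t hy.2) U hU hyU H hH hhH, hfF ⟨hφW, hmaps t hy.2⟩]
    have hd := ((hH.differentiable (by simp)) (φ t y)).hasDerivAt.comp t (hφ.hasDerivAt y t)
    rw [mul_comm]
    refine hd.congr_of_eventuallyEq ?_
    filter_upwards [(hφ.continuous_left y).continuousAt.preimage_mem_nhds (hU.mem_nhds hyU)]
      with s hs
    exact hhH ⟨hs, hmaps s hy.2⟩
  · ext z
    constructor
    · rintro ⟨y, hy, rfl⟩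
      exact ⟨by simpa only [mem_preimage, hφ.neg_apply hK] using hy.1, hmaps t hy.2⟩
    · rintro ⟨hz, hz0⟩
      exact ⟨φ (-t) z, ⟨hz, hmaps _ hz0⟩, hφ.apply_neg hK t z⟩
  · rintro _ ⟨y, hy, rfl⟩
    simpa only [hφ.neg_apply hK] using hy
end

section
/- Let {h₁,...,h_n} be smooth real-valued functions on a differential subspace R of ℝⁿ given by restricting the coordinate functions, and let X, X' be derivations of C^∞(R) such that X·hᵢ = X'·hᵢ for i = 1,...,n. Then X = X', i.e., a derivation of C^∞(R) is uniquely determined by its values on the restricted coordinate functions. -/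
/-- The induced differential structure on a subset `A` of `ℝⁿ`. -/
def CinfSub {n : ℕ} (A : Set (Fin n → ℝ)) : Set (A → ℝ) :=
  {f | ∀ x : A, ∃ U : Set (Fin n → ℝ), IsOpen U ∧ (x : Fin n → ℝ) ∈ U ∧
    ∃ F : (Fin n → ℝ) → ℝ, ContDiff ℝ (⊤ : ℕ∞) F ∧
      ∀ y : A, (y : Fin n → ℝ) ∈ U → f y = F (y : Fin n → ℝ)}

/-- A derivation of a family `C` of functions. -/
def IsDeriv {α : Type*} (C : Set (α → ℝ)) (X : (α → ℝ) → (α → ℝ)) : Prop :=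
  (∀ f ∈ C, X f ∈ C) ∧
  (∀ f ∈ C, ∀ g ∈ C, X (f + g) = X f + X g) ∧
  (∀ (a : ℝ), ∀ f ∈ C, X (a • f) = a • X f) ∧
  (∀ f ∈ C, ∀ g ∈ C, X (f * g) = X f * g + f * X g)

open scoped ContDiff Topology

section Hadamard

universe u

variable {E G : Type u} [NormedAddCommGroup E] [NormedSpace ℝ E] [ProperSpace E]
  [NormedAddCommGroup G] [NormedSpace ℝ G]

theorem hasFDerivAt_intervalIntegral_of_contDiff (a b : ℝ) {g : E × ℝ → G}
    (hg : ContDiff ℝ 1 g) (x₀ : E) :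
    HasFDerivAt (fun x ↦ ∫ t in a..b, g (x, t))
      (∫ t in a..b, (fderiv ℝ g (x₀, t)).comp (ContinuousLinearMap.inl ℝ E ℝ)) x₀ := by
  have hc : Continuous g := hg.continuous
  have hd : Continuous fun p : E × ℝ ↦
      (fderiv ℝ g p).comp (ContinuousLinearMap.inl ℝ E ℝ) :=
    (hg.continuous_fderiv one_ne_zero).clm_comp continuous_const
  obtain ⟨C, hC⟩ := ((isCompact_closedBall x₀ 1).prod (isCompact_uIcc (a := a) (b := b))
    ).exists_bound_of_continuousOn hd.continuousOn
  refine intervalIntegral.hasFDerivAt_integral_of_dominated_of_fderiv_le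
    (F := fun x t ↦ g (x, t))
    (F' := fun x t ↦ (fderiv ℝ g (x, t)).comp (ContinuousLinearMap.inl ℝ E ℝ))
    (bound := fun _ ↦ C) (Metric.ball_mem_nhds x₀ one_pos)
    (.of_forall fun x ↦ (hc.comp (Continuous.prodMk_right x)).aestronglyMeasurable)
    ((hc.comp (Continuous.prodMk_right x₀)).intervalIntegrable _ _)
    (hd.comp (Continuous.prodMk_right x₀)).aestronglyMeasurable
    (.of_forall fun t ht x hx ↦ hC (x, t)
      ⟨Metric.ball_subset_closedBall hx, Set.uIoc_subset_uIcc ht⟩)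
    intervalIntegrable_const (.of_forall fun t _ x _ ↦ ?_)
  exact ((hg.differentiable one_ne_zero) (x, t)).hasFDerivAt.comp x (hasFDerivAt_prodMk_left x t)

theorem contDiff_nat_intervalIntegral (a b : ℝ) (k : ℕ) {g : E × ℝ → G}
    (hg : ContDiff ℝ k g) : ContDiff ℝ k fun x ↦ ∫ t in a..b, g (x, t) := by
  induction k generalizing G with
  | zero =>
    exact contDiff_zero.2 (intervalIntegral.continuous_parametric_intervalIntegral_of_continuous'
      (f := fun x t ↦ g (x, t)) hg.continuous a b)
  | succ k ih =>
    refine contDiff_succ_iff_hasFDerivAt.2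
      ⟨fun x ↦ ∫ t in a..b, (fderiv ℝ g (x, t)).comp (ContinuousLinearMap.inl ℝ E ℝ),
        ih ((hg.fderiv_right (by norm_cast)).clm_comp contDiff_const), fun x ↦
        hasFDerivAt_intervalIntegral_of_contDiff a b (hg.of_le ?_) x⟩
    norm_cast
    omega

/-- Hadamard's lemma: a smooth function is its value at `x` plus a smooth family of continuous
linear maps applied to the displacement from `x`. -/
theorem ContDiff.exists_eq_add_clm_apply_sub {F : E → G}
    [CompleteSpace G] (hF : ContDiff ℝ ∞ F) (x : E) :
    ∃ A : E → E →L[ℝ] G, ContDiff ℝ ∞ A ∧ ∀ y, F y = F x + A y (y - x) := by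
  have hs : ContDiff ℝ ∞ fun p : E × ℝ ↦ fderiv ℝ F (x + p.2 • (p.1 - x)) :=
    (hF.fderiv_right (m := ∞) le_rfl).comp (by fun_prop)
  refine ⟨fun y ↦ ∫ t in (0 : ℝ)..1, fderiv ℝ F (x + t • (y - x)),
    contDiff_infty.2 fun k ↦ contDiff_nat_intervalIntegral 0 1 k (contDiff_infty.1 hs k),
    fun y ↦ ?_⟩
  have hc : Continuous fun t : ℝ ↦ fderiv ℝ F (x + t • (y - x)) :=
    hs.continuous.comp (Continuous.prodMk_right y)
  rw [ContinuousLinearMap.intervalIntegral_apply (hc.intervalIntegrable _ _),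
    intervalIntegral.integral_eq_sub_of_hasDerivAt (f := fun t : ℝ ↦ F (x + t • (y - x)))]
  · simp
  · intro t _
    have h : HasDerivAt (fun t : ℝ ↦ x + t • (y - x)) (y - x) t := by
      simpa using ((hasDerivAt_id t).smul_const (y - x)).const_add x
    exact ((hF.differentiable (by simp)) _).hasFDerivAt.comp_hasDerivAt t h
  · exact (hc.clm_apply continuous_const).intervalIntegrable _ _

end Hadamard

section Derivation

variable {n : ℕ} {R : Set (Fin n → ℝ)} {X : (R → ℝ) → (R → ℝ)}

theorem restrict_mem_CinfSub {F : (Fin n → ℝ) → ℝ} (hF : ContDiff ℝ ∞ F) :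
    R.domRestrict F ∈ CinfSub R :=
  fun _ ↦ ⟨Set.univ, isOpen_univ, trivial, F, hF, fun _ _ ↦ rfl⟩

theorem IsDeriv.map_restrict_const (hX : IsDeriv (CinfSub R) X) (c : ℝ) :
    X (R.domRestrict fun _ ↦ c) = 0 := by
  obtain ⟨-, -, hsmul, hmul⟩ := hX
  have h1 : R.domRestrict (fun _ ↦ (1 : ℝ)) ∈ CinfSub R := restrict_mem_CinfSub contDiff_const
  have h := hmul _ h1 _ h1
  have e : R.domRestrict (fun _ ↦ (1 : ℝ)) = 1 := rfl
  rw [e] at h h1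
  have hc := hsmul c _ h1
  have e' : R.domRestrict (fun _ ↦ c) = c • (1 : R → ℝ) := by ext; simp
  rw [e', hc, show X 1 = 0 by simpa using h, smul_zero]

theorem IsDeriv.map_restrict_sum (hX : IsDeriv (CinfSub R) X) {ι : Type*} (s : Finset ι)
    {F : ι → (Fin n → ℝ) → ℝ} (hF : ∀ i, ContDiff ℝ ∞ (F i)) :
    X (R.domRestrict fun y ↦ ∑ i ∈ s, F i y) = ∑ i ∈ s, X (R.domRestrict (F i)) := by
  classical
  induction s using Finset.induction_on with
  | empty => simpa using hX.map_restrict_const 0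
  | insert i s hi ih =>
    rw [Finset.sum_insert hi, ← ih, ← hX.2.1 _ (restrict_mem_CinfSub (hF i)) _
      (restrict_mem_CinfSub (ContDiff.sum fun i _ ↦ hF i))]
    congr 1
    ext y
    simp [Finset.sum_insert hi]

/-- The chain rule for a derivation applied to the restriction of a smooth function, with
coefficients that do not depend on the derivation. -/
theorem exists_deriv_restrict_eq_sum {F : (Fin n → ℝ) → ℝ} (hF : ContDiff ℝ ∞ F) (x : R) :
    ∃ c : Fin n → ℝ, ∀ X : (R → ℝ) → (R → ℝ), IsDeriv (CinfSub R) X →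
      X (R.domRestrict F) x = ∑ i, X (fun y : R ↦ (y : Fin n → ℝ) i) x * c i := by
  obtain ⟨A, hA, hFA⟩ := hF.exists_eq_add_clm_apply_sub (x : Fin n → ℝ)
  refine ⟨fun i ↦ A x (Pi.single i 1), fun X hX ↦ ?_⟩
  have hg (i : Fin n) : ContDiff ℝ ∞ fun y ↦ A y (Pi.single i 1) := hA.clm_apply contDiff_const
  have hp (i : Fin n) : ContDiff ℝ ∞ fun y : Fin n → ℝ ↦ y i := contDiff_apply ℝ ℝ i
  have hq (i : Fin n) : ContDiff ℝ ∞ fun y : Fin n → ℝ ↦ y i + -(x : Fin n → ℝ) i :=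
    (hp i).add contDiff_const
  have hF' : R.domRestrict F = R.domRestrict (fun _ ↦ F x) + R.domRestrict
      (fun y ↦ ∑ i, (y i + -(x : Fin n → ℝ) i) * A y (Pi.single i 1)) := by
    ext y
    simp only [Set.domRestrict_apply, Pi.add_apply]
    rw [hFA y]
    congr 1
    conv_lhs => rw [pi_eq_sum_univ' ((y : Fin n → ℝ) - (x : Fin n → ℝ))]
    simp [sub_eq_add_neg]
  rw [hF', hX.2.1 _ (restrict_mem_CinfSub contDiff_const) _
      (restrict_mem_CinfSub (ContDiff.sum fun i _ ↦ (hq i).mul (hg i))),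
    hX.map_restrict_const, hX.map_restrict_sum _ fun i ↦ (hq i).mul (hg i), zero_add,
    Finset.sum_apply]
  refine Finset.sum_congr rfl fun i _ ↦ ?_
  have h1 := congrFun (hX.2.2.2 _ (restrict_mem_CinfSub (hq i)) _ (restrict_mem_CinfSub (hg i))) x
  have h2 := hX.2.1 _ (restrict_mem_CinfSub (hp i)) _
    (restrict_mem_CinfSub (contDiff_const (c := -(x : Fin n → ℝ) i)))
  rw [hX.map_restrict_const, add_zero] at h2
  have h3 : X (R.domRestrict fun y ↦ y i + -(x : Fin n → ℝ) i)
      = X (fun y : R ↦ (y : Fin n → ℝ) i) := h2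
  rw [h3] at h1
  refine h1.trans ?_
  simp

/-- A derivation is local: it only sees a local smooth extension. -/
theorem IsDeriv.apply_eq_of_eqOn (hX : IsDeriv (CinfSub R) X) {f : R → ℝ} (hf : f ∈ CinfSub R)
    {F : (Fin n → ℝ) → ℝ} (hF : ContDiff ℝ ∞ F) {U : Set (Fin n → ℝ)} {x : R}
    (hU : U ∈ 𝓝 (x : Fin n → ℝ)) (hfF : ∀ y : R, (y : Fin n → ℝ) ∈ U → f y = F y) :
    X f x = X (R.domRestrict F) x := by
  obtain ⟨φ, hφU, -, hφ, -, hφx⟩ := exists_contDiff_tsupport_subset (n := ⊤) hU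
  have hφm := restrict_mem_CinfSub (R := R) hφ
  have key : R.domRestrict φ * f = R.domRestrict φ * R.domRestrict F := by
    ext y
    by_cases hy : (y : Fin n → ℝ) ∈ U
    · simp [hfF y hy]
    · simp [image_eq_zero_of_notMem_tsupport fun h ↦ hy (hφU h)]
  have h := congrFun (congrArg X key) x
  rw [hX.2.2.2 _ hφm _ hf, hX.2.2.2 _ hφm _ (restrict_mem_CinfSub hF)] at h
  simpa [hφx, hfF x (mem_of_mem_nhds hU)] using h

end Derivation


/-- A derivation of `C^∞(R)`, for `R` a differential subspace of
`ℝⁿ`, is uniquely determined by its values on the restrictions `h₁,...,hₙ` of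
the coordinate functions. -/
theorem stmt_18 {n : ℕ} (R : Set (Fin n → ℝ))
    (X X' : (↥R → ℝ) → (↥R → ℝ))
    (hX : IsDeriv (CinfSub R) X) (hX' : IsDeriv (CinfSub R) X')
    (hcoord : ∀ i : Fin n,
      X (fun y : ↥R => (y : Fin n → ℝ) i) = X' (fun y : ↥R => (y : Fin n → ℝ) i)) :
    ∀ f ∈ CinfSub R, X f = X' f := by
  intro f hf
  ext x
  obtain ⟨U, hU, hxU, F, hF, hfF⟩ := hf x
  have hU' := hU.mem_nhds hxU
  obtain ⟨c, hc⟩ := exists_deriv_restrict_eq_sum hF x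
  rw [hX.apply_eq_of_eqOn hf hF hU' hfF, hX'.apply_eq_of_eqOn hf hF hU' hfF, hc X hX, hc X' hX']
  simp only [hcoord]
end
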